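/- A four-dimensional power-commutative real division algebra contains no exceptional idempotent, and consequently it contains a nonzero central idempotent. -/

import Mathlib

open Module

section Defs

variable {A : Type*} [AddCommGroup A] [Module ℝ A]

/-- A linear subspace closed under the multiplication `m`. -/
def IsSubalg (m : A →ₗ[ℝ] A →ₗ[ℝ] A) (U : Submodule ℝ A) : Prop :=
  ∀ x ∈ U, ∀ y ∈ U, m x y ∈ U

/-- The subalgebra generated by a set `s`: the smallest subspace containing `s`
and closed under multiplication. -/
def genSubalg (m : A →ₗ[ℝ] A →ₗ[ℝ] A) (s : Set A) : Submodule ℝ A :=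
  sInf {U : Submodule ℝ A | IsSubalg m U ∧ s ⊆ (U : Set A)}

/-- `m` is a division-algebra multiplication: for nonzero `a`, both left and
right multiplication by `a` are bijective. -/
def IsDivision (m : A →ₗ[ℝ] A →ₗ[ℝ] A) : Prop :=
  ∀ a : A, a ≠ 0 →
    Function.Bijective (fun x : A => m a x) ∧ Function.Bijective (fun x : A => m x a)

/-- Power-commutativity: every subalgebra generated by a single element is commutative. -/
def PowerComm (m : A →ₗ[ℝ] A →ₗ[ℝ] A) : Prop :=
  ∀ x : A, ∀ a ∈ genSubalg m {x}, ∀ b ∈ genSubalg m {x}, m a b = m b a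

/-- An omnipresent idempotent: a nonzero idempotent contained in every
two-dimensional subalgebra. -/
def Omnipresent (m : A →ₗ[ℝ] A →ₗ[ℝ] A) (e : A) : Prop :=
  e ≠ 0 ∧ m e e = e ∧
    ∀ U : Submodule ℝ A, IsSubalg m U → Module.finrank ℝ U = 2 → e ∈ U

/-- `one` is an identity element for `m` and for every `x` the elements
`one, x, x²` are linearly dependent. -/
def IsQuadraticWith (m : A →ₗ[ℝ] A →ₗ[ℝ] A) (one : A) : Prop :=
  (∀ x : A, m one x = x ∧ m x one = x) ∧
    ∀ x : A, ¬ LinearIndependent ℝ ![one, x, m x x]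

/-- A quadratic algebra: unital, and `1, x, x²` linearly dependent for all `x`. -/
def IsQuadratic (m : A →ₗ[ℝ] A →ₗ[ℝ] A) : Prop :=
  ∃ one : A, IsQuadraticWith m one

/-- The isotope multiplication `x ∘ y = (T x)·(T y)`. -/
def isotope (m : A →ₗ[ℝ] A →ₗ[ℝ] A) (T : A →ₗ[ℝ] A) : A →ₗ[ℝ] A →ₗ[ℝ] A :=
  (m.compl₂ T).comp T

/-- A planar map on a quadratic division algebra with identity `one`:
invertible, fixes `one`, and leaves every subalgebra invariant. -/
def Planar (m : A →ₗ[ℝ] A →ₗ[ℝ] A) (one : A) (T : A →ₗ[ℝ] A) : Prop :=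
  Function.Bijective T ∧ T one = one ∧
    ∀ U : Submodule ℝ A, IsSubalg m U → ∀ x ∈ U, T x ∈ U

/-- The imaginary space `Im B = {x ∉ ℝ·1 : x² ∈ ℝ·1} ∪ {0}` of a quadratic algebra. -/
def ImSet (m : A →ₗ[ℝ] A →ₗ[ℝ] A) (one : A) : Set A :=
  {x : A | x ∉ Submodule.span ℝ {one} ∧ m x x ∈ Submodule.span ℝ {one}} ∪ {0}

/-- The centraliser `C(e) = {y : e·y = y·e}`, a linear subspace. -/
def centraliser (m : A →ₗ[ℝ] A →ₗ[ℝ] A) (e : A) : Submodule ℝ A :=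
  LinearMap.ker (m e - m.flip e)

/-- An exceptional idempotent of a four-dimensional algebra: its centraliser is
three-dimensional and closed under squaring. -/
def Exceptional (m : A →ₗ[ℝ] A →ₗ[ℝ] A) (e : A) : Prop :=
  Module.finrank ℝ (centraliser m e) = 3 ∧
    ∀ x ∈ centraliser m e, m x x ∈ centraliser m e

end Defs

open Polynomial in
theorem Polynomial.exists_isRoot_of_odd_natDegree_of_real {p : ℝ[X]} (hp : Odd p.natDegree) :
    ∃ x, p.IsRoot x := by
  wlog hl : 0 ≤ p.leadingCoeff generalizing p
  · obtain ⟨x, hx⟩ := this (p := -p) (by simpa using hp) (by simpa using (not_le.1 hl).le)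
    exact ⟨x, by simpa using hx⟩
  have hdeg : 0 < p.degree := natDegree_pos_iff_degree_pos.1 hp.pos
  have h₁ := p.tendsto_atTop_of_leadingCoeff_nonneg hdeg hl
  have hq : (-p.comp (-X)).natDegree = p.natDegree := by simp [natDegree_comp]
  have h₂ := (-p.comp (-X)).tendsto_atTop_of_leadingCoeff_nonneg
    (natDegree_pos_iff_degree_pos.1 (hq ▸ hp.pos)) (by
      rw [leadingCoeff_neg, leadingCoeff_comp (by simp)]
      simpa [hp.neg_one_pow] using hl)
  obtain ⟨a, ha⟩ := (h₁.eventually_ge_atTop 0).exists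
  obtain ⟨b, hb⟩ := (h₂.eventually_ge_atTop 0).exists
  exact mem_range_of_exists_le_of_exists_ge p.continuous ⟨-b, by simpa using hb⟩ ⟨a, ha⟩

theorem Module.End.exists_hasEigenvalue_of_odd_finrank {V : Type*} [AddCommGroup V] [Module ℝ V]
    [FiniteDimensional ℝ V] (h : Odd (finrank ℝ V)) (f : Module.End ℝ V) :
    ∃ μ, f.HasEigenvalue μ := by
  obtain ⟨μ, hμ⟩ := Polynomial.exists_isRoot_of_odd_natDegree_of_real
    (p := f.charpoly) (by rwa [LinearMap.charpoly_natDegree])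
  exact ⟨μ, (Module.End.hasEigenvalue_iff_isRoot_charpoly f μ).2 hμ⟩

section Hopf

open Set Topology unitInterval

variable {A : Type*} [NormedAddCommGroup A] [NormedSpace ℝ A] (M : A →L[ℝ] A →L[ℝ] A)

theorem eq_or_eq_neg_of_square_eq (hM : ∀ a b, M a b = 0 → a = 0 ∨ b = 0)
    (hcomm : ∀ a b, M a b = M b a) {x y : A} (h : M x x = M y y) : x = y ∨ x = -y := by
  have : M (x - y) (x + y) = 0 := by
    simp [h, hcomm y x, add_comm]
  rcases hM _ _ this with h | h
  · exact .inl (sub_eq_zero.1 h)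
  · exact .inr (eq_neg_of_add_eq_zero_left h)

variable [FiniteDimensional ℝ A]

theorem tendsto_cocompact_square (hM : ∀ a b, M a b = 0 → a = 0 ∨ b = 0) :
    Filter.Tendsto (fun x => M x x) (Filter.cocompact A) (Filter.cocompact A) := by
  have : ProperSpace A := FiniteDimensional.proper ℝ A
  have hc : Continuous fun x => ‖M x x‖ := by fun_prop
  obtain ⟨c, hc0, hc⟩ : ∃ c > 0, ∀ x : A, c * ‖x‖ ^ 2 ≤ ‖M x x‖ := by
    rcases (Metric.sphere (0 : A) 1).eq_empty_or_nonempty with he | hne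
    · refine ⟨1, one_pos, fun x => ?_⟩
      by_cases hx : x = 0
      · simp [hx]
      · exact absurd (he ▸ (by simp [norm_smul, hx] : ‖x‖⁻¹ • x ∈ Metric.sphere (0 : A) 1))
          (notMem_empty _)
    · obtain ⟨z, hz, hmin⟩ := (isCompact_sphere (0 : A) 1).exists_isMinOn hne hc.continuousOn
      have hz0 : z ≠ 0 := by rintro rfl; simp at hz
      refine ⟨‖M z z‖, norm_pos_iff.2 fun h => hz0 ((hM _ _ h).elim id id), fun x => ?_⟩
      by_cases hx : x = 0
      · simp [hx]
      have hx' : ‖x‖ ≠ 0 := norm_ne_zero_iff.2 hx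
      have := hmin (by simp [norm_smul, hx] : ‖x‖⁻¹ • x ∈ Metric.sphere (0 : A) 1)
      simp only [mem_ofPred_eq, map_smul, smul_apply, norm_smul, norm_inv,
        norm_norm] at this
      rw [← mul_assoc, ← mul_inv, ← sq, inv_mul_eq_div, le_div_iff₀ (by positivity)] at this
      exact this
  refine tendsto_cocompact_of_tendsto_dist_comp_atTop 0 ?_
  simp only [dist_zero_right]
  refine Filter.tendsto_atTop_mono hc ?_
  exact ((Filter.tendsto_pow_atTop two_ne_zero).comp tendsto_norm_cocompact_atTop).const_mul_atTop
    hc0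

theorem isLocalHomeomorphOn_square (hM : ∀ a b, M a b = 0 → a = 0 ∨ b = 0)
    (hcomm : ∀ a b, M a b = M b a) : IsLocalHomeomorphOn (fun x => M x x) {0}ᶜ := by
  have : CompleteSpace A := FiniteDimensional.complete ℝ A
  intro x hx
  have hinj : LinearMap.ker (((2 : ℝ) • M x : A →L[ℝ] A) : A →ₗ[ℝ] A) = ⊥ := by
    refine LinearMap.ker_eq_bot'.2 fun y hy => ?_
    have : M x y = 0 := by simpa using hy
    exact (hM _ _ this).resolve_left hx
  let e : A ≃L[ℝ] A := (LinearEquiv.ofInjectiveEndo _ (LinearMap.ker_eq_bot.1 hinj)).toContinuousLinearEquiv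
  have hd : HasStrictFDerivAt (fun x => M x x) (e : A →L[ℝ] A) x := by
    have he : (e : A →L[ℝ] A) = (M x).comp (.id ℝ A) + M.flip x := by
      ext y
      change (2 : ℝ) • M x y = M x y + M y x
      rw [two_smul, hcomm y x]
    exact he ▸ M.hasStrictFDerivAt.clm_apply (hasStrictFDerivAt_id x)
  exact ⟨hd.toOpenPartialHomeomorph _, hd.mem_toOpenPartialHomeomorph_source, rfl⟩

theorem isCoveringMapOn_square (hM : ∀ a b, M a b = 0 → a = 0 ∨ b = 0)
    (hcomm : ∀ a b, M a b = M b a) : IsCoveringMapOn (fun x => M x x) {0}ᶜ := by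
  have : ProperSpace A := FiniteDimensional.proper ℝ A
  have hcont : Continuous fun x => M x x := by fun_prop
  refine IsClosedMap.isCoveringMapOn_of_isLocalHomeomorphOn
    (isProperMap_iff_tendsto_cocompact.2 ⟨hcont, tendsto_cocompact_square M hM⟩).isClosedMap
    (fun w _ => ?_) ?_
  · rcases ((fun x => M x x) ⁻¹' {w}).eq_empty_or_nonempty with he | ⟨z, hz⟩
    · simp [he]
    · refine (Set.toFinite {z, -z}).subset fun y hy => ?_
      exact eq_or_eq_neg_of_square_eq M hM hcomm (hy.trans hz.symm)
  · refine (isLocalHomeomorphOn_square M hM hcomm).mono fun x hx => ?_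
    rintro rfl
    simp at hx

theorem ContinuousLinearMap.finrank_le_three_of_commutative (hM : ∀ a b, M a b = 0 → a = 0 ∨ b = 0)
    (hcomm : ∀ a b, M a b = M b a) : finrank ℝ A ≤ 3 := by
  by_contra! hdim
  obtain ⟨x, hx⟩ : ∃ x : A, x ≠ 0 := by
    have : Nontrivial A := Module.nontrivial_of_finrank_pos (R := ℝ) (by omega)
    exact exists_ne 0
  obtain ⟨y, hy⟩ : ∃ y, y ∉ Submodule.span ℝ {x} := by
    by_contra! h
    have := finrank_span_singleton (K := ℝ) hx
    rw [(Submodule.eq_top_iff'.2 h), finrank_top] at this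
    omega
  obtain ⟨w, hw⟩ : ∃ w, w ∉ Submodule.span ℝ (Set.range ![M x x, M x y, M y y]) := by
    by_contra! h
    have := finrank_range_le_card (R := ℝ) ![M x x, M x y, M y y]
    rw [Set.finrank, (Submodule.eq_top_iff'.2 h), finrank_top] at this
    simp at this
    omega
  set S := Submodule.span ℝ (Set.range ![M x x, M x y, M y y])
  have cov := (isCoveringMapOn_square M hM hcomm).isCoveringMap_restrictPreimage
  set p := ({0}ᶜ : Set A).restrictPreimage (fun x => M x x) with hp
  have hne : ∀ z, z ≠ 0 → z ∈ (fun x => M x x) ⁻¹' ({0}ᶜ : Set A) := fun z hz h =>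
    hz ((hM _ _ h).elim id id)
  let g : ℝ → A := fun t => Real.cos (Real.pi * t) • x + Real.sin (Real.pi * t) • y
  have hg : ∀ t, g t ≠ 0 := by
    intro t ht
    have h1 : Real.sin (Real.pi * t) = 0 := by
      by_contra h
      refine hy (Submodule.mem_span_singleton.2 ⟨-(Real.cos (Real.pi * t) / Real.sin (Real.pi * t)), ?_⟩)
      have h2 : y = -((Real.sin (Real.pi * t))⁻¹ • Real.cos (Real.pi * t) • x) := by
        rw [eq_neg_of_add_eq_zero_left ht, smul_neg, neg_neg, inv_smul_smul₀ h]
      rw [h2, smul_smul, neg_smul]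
      congr 2
      field_simp
    have h2 : Real.cos (Real.pi * t) = 0 := by simpa [g, h1, hx] using ht
    have := Real.sin_sq_add_cos_sq (Real.pi * t)
    simp [h1, h2] at this
  have hgS : ∀ t, M (g t) (g t) ∈ S := by
    intro t
    have h (i) : ![M x x, M x y, M y y] i ∈ S := Submodule.subset_span ⟨i, rfl⟩
    simp only [g, map_add, map_smul, add_apply, smul_apply,
      hcomm y x]
    exact S.add_mem (S.smul_mem _ (S.add_mem (S.smul_mem _ (h 0)) (S.smul_mem _ (h 1))))
      (S.smul_mem _ (S.add_mem (S.smul_mem _ (h 1)) (S.smul_mem _ (h 2))))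
  let h : ℝ → ℝ → A := fun s t => (1 - s) • M (g t) (g t) + s • w
  have hh : ∀ s t, h s t ≠ 0 := by
    intro s t hst
    by_cases hs : s = 0
    · simp only [h, hs, sub_zero, one_smul, zero_smul, add_zero] at hst
      exact hne _ (hg t) hst
    · refine hw ?_
      rw [← inv_smul_smul₀ hs w, eq_neg_of_add_eq_zero_right hst]
      exact S.smul_mem _ (S.neg_mem (S.smul_mem _ (hgS t)))
  let f : C(I, (fun x => M x x) ⁻¹' ({0}ᶜ : Set A)) :=
    ⟨fun t => ⟨g t, hne _ (hg t)⟩, by fun_prop⟩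
  let H : C(I × I, ({0}ᶜ : Set A)) := ⟨fun u => ⟨h u.1 u.2, hh _ _⟩, by fun_prop⟩
  have H0 : ∀ a, H (0, a) = p (f a) := by
    intro a
    apply Subtype.ext
    simp [H, h, f, p]
  let G := cov.liftHomotopy H f H0
  have hG : ∀ s t, p (G (s, t)) = H (s, t) := fun s t => congr_fun (cov.liftHomotopy_lifts H f H0) _
  have hends : ∀ s, p (G (s, 0)) = p (G (s, 1)) := by
    intro s
    rw [hG, hG]
    apply Subtype.ext
    simp [H, h, g]
  have hconst : G (1, 0) = G (1, 1) :=
    cov.const_of_comp (g := fun t => G (1, t)) (by fun_prop) (fun a a' => by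
      rw [hG, hG]
      apply Subtype.ext
      simp [H, h]) 0 1
  have hall := cov.eq_of_comp_eq (g₁ := fun s => G (s, 0)) (g₂ := fun s => G (s, 1))
    (by fun_prop) (by fun_prop) (funext hends) 1 hconst
  have h0 := congr_fun hall 0
  simp only [G, cov.liftHomotopy_zero] at h0
  have h1 : x = -x := by simpa [f, g] using congr_arg Subtype.val h0
  refine hx (smul_eq_zero.1 (?_ : (2 : ℝ) • x = 0) |>.resolve_left two_ne_zero)
  rw [two_smul]
  exact eq_neg_iff_add_eq_zero.1 h1

end Hopf

theorem LinearMap.finrank_le_three_of_commutative {A : Type*} [AddCommGroup A] [Module ℝ A]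
    [FiniteDimensional ℝ A] (m : A →ₗ[ℝ] A →ₗ[ℝ] A) (hm : ∀ a b, m a b = 0 → a = 0 ∨ b = 0)
    (hcomm : ∀ a b, m a b = m b a) : finrank ℝ A ≤ 3 := by
  let φ := (finBasis ℝ A).equivFun
  let : NormedAddCommGroup A := NormedAddCommGroup.induced A (Fin (finrank ℝ A) → ℝ) φ φ.injective
  let : NormedSpace ℝ A := NormedSpace.induced ℝ A (Fin (finrank ℝ A) → ℝ) φ
  exact ContinuousLinearMap.finrank_le_three_of_commutative
    (LinearMap.toContinuousLinearMap
      ((LinearMap.toContinuousLinearMap : (A →ₗ[ℝ] A) ≃ₗ[ℝ] (A →L[ℝ] A)).toLinearMap ∘ₗ m)) hm hcomm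

section Independence

variable {V : Type*} [AddCommGroup V] [Module ℝ V]

theorem not_linearIndependent_of_tendsto_zero [FiniteDimensional ℝ V] {p₀ p₁ q₀ q₁ r₀ r₁ r₂ : V}
    (h : ∀ t : ℝ, t ≠ 0 → ¬ LinearIndependent ℝ
      ![p₀ + t • p₁, q₀ + t • q₁, r₀ + t • r₁ + t ^ 2 • r₂]) :
    ¬ LinearIndependent ℝ ![p₀, q₀, r₀] := by
  intro hli
  let φ := (finBasis ℝ V).equivFun
  let F : ℝ → Fin 3 → Fin (finrank ℝ V) → ℝ :=
    fun t => ![φ p₀ + t • φ p₁, φ q₀ + t • φ q₁, φ r₀ + t • φ r₁ + t ^ 2 • φ r₂]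
  have hF : ∀ t, F t = φ ∘ ![p₀ + t • p₁, q₀ + t • q₁, r₀ + t • r₁ + t ^ 2 • r₂] := by
    intro t
    ext i
    fin_cases i <;> simp [F]
  have hcont : Continuous F := by
    refine continuous_pi fun i => ?_
    fin_cases i <;> simp only [F] <;> simp <;> fun_prop
  have hopen : IsOpen {t | LinearIndependent ℝ (F t)} :=
    isOpen_setOfPred_linearIndependent.preimage hcont
  have h0 : (0 : ℝ) ∈ {t | LinearIndependent ℝ (F t)} := by
    simp only [Set.mem_ofPred_eq, hF]
    exact (by simpa using hli : LinearIndependent ℝ _).map' φ.toLinearMap φ.ker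
  have hev : ∀ᶠ t in nhdsWithin (0 : ℝ) {0}ᶜ, LinearIndependent ℝ (F t) :=
    mem_nhdsWithin_of_mem_nhds (hopen.mem_nhds h0)
  obtain ⟨t, ht, ht0⟩ := (hev.and self_mem_nhdsWithin).exists
  rw [hF] at ht
  exact h t ht0 (LinearIndependent.of_comp φ.toLinearMap ht)

theorem not_linearIndependent_of_mem {U : Submodule ℝ V} [FiniteDimensional ℝ U] (hU : finrank ℝ U ≤ 2)
    {x y z : V} (hx : x ∈ U) (hy : y ∈ U) (hz : z ∈ U) : ¬ LinearIndependent ℝ ![x, y, z] := by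
  intro h
  have h1 := finrank_span_eq_card h
  have h2 : Submodule.span ℝ (Set.range ![x, y, z]) ≤ U := by
    rw [Submodule.span_le]
    rintro _ ⟨i, rfl⟩
    fin_cases i <;> assumption
  have := Submodule.finrank_mono h2
  simp at h1
  omega

theorem finrank_span_pair_le (x y : V) : finrank ℝ (Submodule.span ℝ {x, y}) ≤ 2 := by
  classical
  have := finrank_span_finset_le_card (R := ℝ) ({x, y} : Finset V)
  rw [Set.finrank, Finset.coe_pair] at this
  exact this.trans Finset.card_le_two

theorem span_pair_eq {U : Submodule ℝ V} [FiniteDimensional ℝ U] (hU : finrank ℝ U ≤ 2) {x y : V}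
    (hx : x ∈ U) (hy : y ∈ U) (hx0 : x ≠ 0) (hxy : y ∉ Submodule.span ℝ {x}) :
    Submodule.span ℝ {x, y} = U := by
  have hle : Submodule.span ℝ {x, y} ≤ U := by
    simp [Submodule.span_le, Set.insert_subset_iff, hx, hy]
  have := Submodule.finiteDimensional_of_le hle
  have hlt : Submodule.span ℝ {x} < Submodule.span ℝ {x, y} :=
    SetLike.lt_iff_le_and_exists.2 ⟨Submodule.span_mono (by simp), y,
      Submodule.subset_span (by simp), hxy⟩
  have h1 := Submodule.finrank_lt_finrank_of_lt hlt
  rw [finrank_span_singleton hx0] at h1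
  exact Submodule.eq_of_le_of_finrank_le hle (by omega)

theorem span_triple_eq {U : Submodule ℝ V} [FiniteDimensional ℝ U] (hU : finrank ℝ U ≤ 3)
    {x y z : V} (hx : x ∈ U) (hy : y ∈ U) (hz : z ∈ U) (hx0 : x ≠ 0)
    (hxy : y ∉ Submodule.span ℝ {x}) (hxyz : z ∉ Submodule.span ℝ {x, y}) :
    Submodule.span ℝ {x, y, z} = U ∧ finrank ℝ U = 3 := by
  have hle : Submodule.span ℝ {x, y, z} ≤ U := by
    simp [Submodule.span_le, Set.insert_subset_iff, hx, hy, hz]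
  have := Submodule.finiteDimensional_of_le hle
  have hlt : Submodule.span ℝ {x, y} < Submodule.span ℝ {x, y, z} :=
    SetLike.lt_iff_le_and_exists.2 ⟨Submodule.span_mono (by grind), z,
      Submodule.subset_span (by simp), hxyz⟩
  have := Submodule.finiteDimensional_of_le hlt.le
  have hlt' : Submodule.span ℝ {x} < Submodule.span ℝ {x, y} :=
    SetLike.lt_iff_le_and_exists.2 ⟨Submodule.span_mono (by simp), y,
      Submodule.subset_span (by simp), hxy⟩
  have h1 := Submodule.finrank_lt_finrank_of_lt hlt
  have h2 := Submodule.finrank_lt_finrank_of_lt hlt'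
  rw [finrank_span_singleton hx0] at h2
  have h3 := Submodule.finrank_mono hle
  exact ⟨Submodule.eq_of_le_of_finrank_le hle (by omega), by omega⟩

theorem linearIndependent_triple {x y z : V} (hx : x ≠ 0) (hy : y ∉ Submodule.span ℝ {x})
    (hz : z ∉ Submodule.span ℝ {x, y}) : LinearIndependent ℝ ![x, y, z] := by
  classical
  have hle : finrank ℝ (Submodule.span ℝ {x, y, z}) ≤ 3 := by
    have := finrank_span_finset_le_card (R := ℝ) ({x, y, z} : Finset V)
    rw [Set.finrank, Finset.coe_insert, Finset.coe_pair] at this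
    exact this.trans Finset.card_le_three
  have := FiniteDimensional.span_of_finite ℝ (Set.toFinite {x, y, z})
  have h := (span_triple_eq hle (Submodule.subset_span (by simp)) (Submodule.subset_span (by simp))
    (Submodule.subset_span (by simp)) hx hy hz).2
  rw [linearIndependent_iff_card_eq_finrank_span, Set.finrank]
  have hr : Set.range ![x, y, z] = {x, y, z} := by
    ext v
    simp [eq_comm]
    tauto
  rw [hr, h, Fintype.card_fin]

theorem coeff_eq_zero_of_notMem {U : Submodule ℝ V} {x y : V} (hx : x ∈ U) (hy : y ∉ U) {c : ℝ}
    (h : c • y + x = 0) : c = 0 := by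
  by_contra hc
  refine hy ((U.smul_mem_iff hc).1 ?_)
  rw [eq_neg_of_add_eq_zero_left h]
  exact U.neg_mem hx

end Independence

section Planes

variable {V : Type*} [AddCommGroup V] [Module ℝ V]

theorem exists_mem_notMem_of_finrank_lt {U W : Submodule ℝ V} [FiniteDimensional ℝ W]
    (h : finrank ℝ W < finrank ℝ U) : ∃ x ∈ U, x ∉ W := by
  by_contra! hle
  exact h.not_ge (Submodule.finrank_mono hle)

theorem coeff_pair_eq_zero {x y : V} (hx : x ≠ 0) (hy : y ∉ Submodule.span ℝ {x}) {a b : ℝ}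
    (h : a • x + b • y = 0) : a = 0 ∧ b = 0 := by
  have hb : b = 0 := coeff_eq_zero_of_notMem
    (Submodule.smul_mem _ a (Submodule.mem_span_singleton_self x)) hy ((add_comm _ _).trans h)
  subst hb
  simpa [hx] using h

theorem coeff_pair_eq {x y : V} (hx : x ≠ 0) (hy : y ∉ Submodule.span ℝ {x}) {a b c d : ℝ}
    (h : a • x + b • y = c • x + d • y) : a = c ∧ b = d := by
  have := coeff_pair_eq_zero hx hy (a := a - c) (b := b - d) (by linear_combination (norm := module) h)
  exact ⟨sub_eq_zero.1 this.1, sub_eq_zero.1 this.2⟩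

end Planes

section PowerPlanar

variable {A : Type*} [AddCommGroup A] [Module ℝ A] {m : A →ₗ[ℝ] A →ₗ[ℝ] A}

theorem mem_centraliser {e y : A} : y ∈ centraliser m e ↔ m e y = m y e := by
  simp [centraliser, sub_eq_zero]

theorem IsSubalg.finrank_ne_three [FiniteDimensional ℝ A] {U : Submodule ℝ A}
    (hU : IsSubalg m U) (hm : ∀ a b, m a b = 0 → a = 0 ∨ b = 0) : finrank ℝ U ≠ 3 := by
  intro h3
  obtain ⟨a, haU, ha⟩ := exists_mem_notMem_of_finrank_lt (U := U) (W := ⊥) (by simp [h3])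
  have ha : a ≠ 0 := by simpa using ha
  obtain ⟨b, hbU, hb⟩ := exists_mem_notMem_of_finrank_lt (U := U) (W := Submodule.span ℝ {a})
    (by simp [h3, finrank_span_singleton ha])
  let L : ∀ x ∈ U, Module.End ℝ U := fun x hx => (m x).restrict fun y hy => hU x hx y hy
  have hinj : Function.Injective (L a haU) := by
    rw [injective_iff_map_eq_zero]
    intro x hx
    have : m a x = 0 := congrArg Subtype.val hx
    exact Subtype.ext ((hm a x this).resolve_left ha)
  let E := LinearEquiv.ofInjectiveEndo (L a haU) hinj
  obtain ⟨μ, hμ⟩ := Module.End.exists_hasEigenvalue_of_odd_finrank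
    (by rw [h3]; decide) (E.symm.toLinearMap ∘ₗ L b hbU)
  obtain ⟨v, hv⟩ := hμ.exists_hasEigenvector
  have h1 : L b hbU v = μ • L a haU v := by
    have := congrArg E hv.apply_eq_smul
    simpa [E] using this
  have h2 : m b v = μ • m a v := congrArg Subtype.val h1
  have h3 : m (b - μ • a) v = 0 := by simp [h2]
  rcases hm _ _ h3 with h | h
  · exact hb (Submodule.mem_span_singleton.2 ⟨μ, (sub_eq_zero.1 h).symm⟩)
  · exact hv.2 (Subtype.ext h)

/-- A multiplication without zero divisors for which `x` and `x²` span a commutative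
subalgebra, for every `x`. -/
structure PowerPlanar (m : A →ₗ[ℝ] A →ₗ[ℝ] A) : Prop where
  eq_zero : ∀ a b, m a b = 0 → a = 0 ∨ b = 0
  isSubalg : ∀ a, IsSubalg m (Submodule.span ℝ {a, m a a})
  comm : ∀ a, ∀ x ∈ Submodule.span ℝ {a, m a a}, ∀ y ∈ Submodule.span ℝ {a, m a a}, m x y = m y x

theorem IsDivision.eq_zero (hdiv : IsDivision m) (a b : A) (h : m a b = 0) : a = 0 ∨ b = 0 := by
  by_contra! hab
  exact hab.2 ((hdiv a hab.1).1.1 (by simpa using h))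

theorem isSubalg_genSubalg (s : Set A) : IsSubalg m (genSubalg m s) := by
  intro x hx y hy
  simp only [genSubalg, Submodule.mem_sInf] at hx hy ⊢
  exact fun U hU => hU.1 x (hx U hU) y (hy U hU)

theorem subset_genSubalg (s : Set A) : s ⊆ genSubalg m s := by
  intro x hx
  simp only [genSubalg, SetLike.mem_coe, Submodule.mem_sInf]
  exact fun U hU => hU.2 hx

theorem PowerComm.powerPlanar [FiniteDimensional ℝ A] (hdim : finrank ℝ A = 4)
    (hdiv : IsDivision m) (hpc : PowerComm m) : PowerPlanar m := by
  have hm := hdiv.eq_zero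
  have hmem : ∀ a, a ∈ genSubalg m {a} := fun a => subset_genSubalg _ rfl
  have hle : ∀ a, Submodule.span ℝ {a, m a a} ≤ genSubalg m {a} := by
    intro a
    simp [Submodule.span_le, Set.insert_subset_iff, hmem a, isSubalg_genSubalg _ _ (hmem a) _ (hmem a)]
  refine ⟨hm, fun a => ?_, fun a x hx y hy => hpc a x (hle a hx) y (hle a hy)⟩
  by_cases haa : m a a ∈ Submodule.span ℝ {a}
  · have : Submodule.span ℝ {a, m a a} = Submodule.span ℝ {a} := by
      rw [Set.pair_comm, Submodule.span_insert_eq_span haa]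
    rw [this]
    intro x hx y hy
    obtain ⟨s, rfl⟩ := Submodule.mem_span_singleton.1 hx
    obtain ⟨t, rfl⟩ := Submodule.mem_span_singleton.1 hy
    simpa using Submodule.smul_mem _ _ (Submodule.smul_mem _ _ haa)
  · have ha : a ≠ 0 := by
      rintro rfl
      simp at haa
    have h4 : finrank ℝ (genSubalg m {a}) ≠ 4 := by
      intro h
      have htop : genSubalg m {a} = ⊤ := Submodule.eq_top_of_finrank_eq (h.trans hdim.symm)
      have := LinearMap.finrank_le_three_of_commutative m hm fun x y =>
        hpc a x (htop ▸ Submodule.mem_top) y (htop ▸ Submodule.mem_top)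
      omega
    have h3 := (isSubalg_genSubalg (m := m) {a}).finrank_ne_three hm
    have hlt := Submodule.finrank_le (genSubalg m {a})
    rw [span_pair_eq (by omega) (hmem a) (isSubalg_genSubalg _ _ (hmem a) _ (hmem a)) ha haa]
    exact isSubalg_genSubalg _

theorem exists_smul_idempotent (hm : ∀ a b, m a b = 0 → a = 0 ∨ b = 0) {x : A} (hx : x ≠ 0)
    (hxx : m x x ∈ Submodule.span ℝ {x}) : ∃ c : ℝ, c ≠ 0 ∧ m (c • x) (c • x) = c • x := by
  obtain ⟨d, hd⟩ := Submodule.mem_span_singleton.1 hxx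
  have hd0 : d ≠ 0 := by
    rintro rfl
    have := hm x x (by simpa using hd.symm)
    tauto
  refine ⟨d⁻¹, inv_ne_zero hd0, ?_⟩
  simp [← hd, smul_smul, hd0]

theorem eq_of_idempotent_of_mem_span_singleton {f g : A} (hf : m f f = f) (hg : m g g = g)
    (hf0 : f ≠ 0) (hg0 : g ≠ 0) (h : g ∈ Submodule.span ℝ {f}) : g = f := by
  obtain ⟨c, rfl⟩ := Submodule.mem_span_singleton.1 h
  have hc : c ≠ 0 := by
    rintro rfl
    simp at hg0
  have : (c * (c - 1)) • f = 0 := by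
    simp only [map_smul, LinearMap.smul_apply, hf] at hg
    linear_combination (norm := module) hg
  have : c * (c - 1) = 0 := (smul_eq_zero.1 this).resolve_right hf0
  have : c = 1 := by grind
  rw [this, one_smul]

theorem eq_of_four_idempotents (hm : ∀ a b, m a b = 0 → a = 0 ∨ b = 0) {U : Submodule ℝ A}
    [FiniteDimensional ℝ U] (hU : finrank ℝ U ≤ 2) {u v w z : A} (huU : u ∈ U) (hvU : v ∈ U)
    (hwU : w ∈ U) (hzU : z ∈ U) (hu : m u u = u) (hv : m v v = v) (hw : m w w = w) (hz : m z z = z)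
    (hu0 : u ≠ 0) (hv0 : v ≠ 0) (hw0 : w ≠ 0) (hz0 : z ≠ 0) (huv : v ≠ u) (huw : w ≠ u)
    (huz : z ≠ u) (hvw : w ≠ v) (hvz : z ≠ v) : z = w := by
  have hvu : v ∉ Submodule.span ℝ {u} := fun h =>
    huv (eq_of_idempotent_of_mem_span_singleton hu hv hu0 hv0 h)
  have hspan := span_pair_eq hU huU hvU hu0 hvu
  have key : ∀ x ∈ U, m x x = x → x ≠ 0 → x ≠ u → x ≠ v → ∃ α β : ℝ, α ≠ 0 ∧ β ≠ 0 ∧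
      x = α • u + β • v ∧
      (α * β) • (m u v + m v u) = (α - α ^ 2) • u + (β - β ^ 2) • v := by
    intro x hxU hx hx0 hxu hxv
    obtain ⟨α, β, rfl⟩ := Submodule.mem_span_pair.1 (hspan ▸ hxU)
    refine ⟨α, β, ?_, ?_, rfl, ?_⟩
    · rintro rfl
      exact hxv (eq_of_idempotent_of_mem_span_singleton hv hx hv0 hx0
        (Submodule.mem_span_singleton.2 ⟨β, by simp⟩))
    · rintro rfl
      exact hxu (eq_of_idempotent_of_mem_span_singleton hu hx hu0 hx0
        (Submodule.mem_span_singleton.2 ⟨α, by simp⟩))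
    · simp only [map_add, map_smul, LinearMap.add_apply, LinearMap.smul_apply, hu, hv] at hx
      linear_combination (norm := module) hx
  obtain ⟨α, β, hα, hβ, rfl, hs⟩ := key w hwU hw hw0 huw hvw
  obtain ⟨γ, δ, hγ, hδ, rfl, hs'⟩ := key z hzU hz hz0 huz hvz
  have h : (γ * δ * (α - α ^ 2)) • u + (γ * δ * (β - β ^ 2)) • v
      = (α * β * (γ - γ ^ 2)) • u + (α * β * (δ - δ ^ 2)) • v := by
    linear_combination (norm := module) (α * β) • hs' - (γ * δ) • hs
  obtain ⟨h1, h2⟩ := coeff_pair_eq hu0 hvu h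
  have h1 : δ * (1 - α) = β * (1 - γ) := by
    apply mul_left_cancel₀ (mul_ne_zero hα hγ)
    linear_combination h1
  have h2 : γ * (1 - β) = α * (1 - δ) := by
    apply mul_left_cancel₀ (mul_ne_zero hβ hδ)
    linear_combination h2
  have h3 : (δ - β) * (1 - (α + β)) = 0 := by grind
  rcases mul_eq_zero.1 h3 with h | h
  · have : δ = β := by linarith
    have : γ = α := by grind
    simp [*]
  · have hs2 : (α * β) • (m u v + m v u - u - v) = 0 := by
      have h4 : α - α ^ 2 = α * β := by linear_combination α * h
      have h5 : β - β ^ 2 = α * β := by linear_combination β * h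
      rw [h4, h5] at hs
      linear_combination (norm := module) hs
    have hs3 := (smul_eq_zero.1 hs2).resolve_left (mul_ne_zero hα hβ)
    have : m (v - u) (v - u) = 0 := by
      simp only [map_sub, LinearMap.sub_apply, hu, hv]
      linear_combination (norm := module) -hs3
    exact absurd (sub_eq_zero.1 (or_self_iff.1 (hm _ _ this))) huv

theorem finite_setOf_idempotent (hm : ∀ a b, m a b = 0 → a = 0 ∨ b = 0) (U : Submodule ℝ A)
    [FiniteDimensional ℝ U] (hU : finrank ℝ U ≤ 2) : {f | f ∈ U ∧ m f f = f}.Finite := by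
  by_contra hinf
  have hinf' : ({f | f ∈ U ∧ m f f = f} \ {0}).Infinite := Set.Infinite.sdiff hinf (Set.finite_singleton 0)
  let g := hinf'.natEmbedding
  have hU' : ∀ n, (g n : A) ∈ U := fun n => (g n).2.1.1
  have hid : ∀ n, m (g n) (g n) = g n := fun n => (g n).2.1.2
  have h0 : ∀ n, (g n : A) ≠ 0 := fun n => (g n).2.2
  have hne : ∀ i j, i ≠ j → (g i : A) ≠ g j := fun i j hij h => hij (g.injective (Subtype.ext h))
  exact hne 3 2 (by decide) <| eq_of_four_idempotents hm hU (hU' 0) (hU' 1) (hU' 2) (hU' 3) (hid 0)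
    (hid 1) (hid 2) (hid 3) (h0 0) (h0 1) (h0 2) (h0 3) (hne 1 0 (by decide)) (hne 2 0 (by decide))
    (hne 3 0 (by decide)) (hne 2 1 (by decide)) (hne 3 1 (by decide))

theorem finite_setOf_square_mem_span_singleton (hm : ∀ a b, m a b = 0 → a = 0 ∨ b = 0) {a e : A}
    (he : e ≠ 0) (ha : a ∉ Submodule.span ℝ {e}) :
    {t : ℝ | m (a + t • e) (a + t • e) ∈ Submodule.span ℝ {a + t • e}}.Finite := by
  have h0 : ∀ t : ℝ, a + t • e ≠ 0 := fun t h =>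
    ha (Submodule.mem_span_singleton.2 ⟨-t, by linear_combination (norm := module) -h⟩)
  have hex : ∀ t ∈ {t : ℝ | m (a + t • e) (a + t • e) ∈ Submodule.span ℝ {a + t • e}},
      ∃ c : ℝ, c ≠ 0 ∧ m (c • (a + t • e)) (c • (a + t • e)) = c • (a + t • e) :=
    fun t ht => exists_smul_idempotent hm (h0 t) ht
  choose! c hc0 hc using hex
  have := FiniteDimensional.span_of_finite ℝ (Set.toFinite {a, e})
  refine Set.Finite.of_injOn (f := fun t => c t • (a + t • e))
    (t := {f | f ∈ Submodule.span ℝ {a, e} ∧ m f f = f}) ?_ ?_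
    (finite_setOf_idempotent hm _ (finrank_span_pair_le a e))
  · exact fun t ht => ⟨Submodule.mem_span_pair.2 ⟨c t, c t * t, by module⟩, hc t ht⟩
  · intro s hs t ht h
    obtain ⟨h1, h2⟩ := coeff_pair_eq he ha (a := c s * s) (b := c s) (c := c t * t) (d := c t)
      (by linear_combination (norm := module) h)
    rw [h2] at h1
    exact mul_left_cancel₀ (hc0 t ht) h1

namespace PowerPlanar

variable (hP : PowerPlanar m)

include hP

theorem mul_square_comm (a : A) : m a (m a a) = m (m a a) a :=
  hP.comm a _ (Submodule.subset_span (by simp)) _ (Submodule.subset_span (by simp))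

theorem mul_square_comm_polarized (x y : A) :
    m x (m x y + m y x) + m y (m x x) = m (m x y + m y x) x + m (m x x) y := by
  have h1 := hP.mul_square_comm (x + y)
  have h2 := hP.mul_square_comm (x - y)
  have h3 := hP.mul_square_comm y
  simp only [map_add, map_sub, LinearMap.add_apply, LinearMap.sub_apply] at h1 h2 ⊢
  linear_combination (norm := module) (1 / 2 : ℝ) • h1 - (1 / 2 : ℝ) • h2 - h3

theorem mul_mem_centraliser {e y : A} (he : m e e = e) (hy : y ∈ centraliser m e) :
    m e y ∈ centraliser m e := by
  rw [mem_centraliser] at hy ⊢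
  have h := hP.mul_square_comm_polarized e y
  rw [he, ← hy] at h
  simp only [map_add, LinearMap.add_apply] at h
  linear_combination (norm := module) (1 / 2 : ℝ) • h

theorem anticommutator_sub_mem_centraliser {e : A} (he : m e e = e) (y : A) :
    m e y + m y e - y ∈ centraliser m e := by
  rw [mem_centraliser]
  have h := hP.mul_square_comm_polarized e y
  rw [he] at h
  simp only [map_add, map_sub, LinearMap.add_apply, LinearMap.sub_apply] at h ⊢
  linear_combination (norm := module) h

end PowerPlanar

end PowerPlanar

section Exceptional

variable {A : Type*} [AddCommGroup A] [Module ℝ A] {m : A →ₗ[ℝ] A →ₗ[ℝ] A}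

theorem mem_centraliser_comm {e y : A} : y ∈ centraliser m e ↔ e ∈ centraliser m y := by
  rw [mem_centraliser, mem_centraliser, eq_comm]

theorem self_mem_centraliser (e : A) : e ∈ centraliser m e := mem_centraliser.2 rfl

theorem Submodule.exists_mem_inf_ne_zero_of_finrank_lt [FiniteDimensional ℝ A] {U W : Submodule ℝ A}
    (h : finrank ℝ A < finrank ℝ U + finrank ℝ W) : ∃ z ∈ U, z ∈ W ∧ z ≠ 0 := by
  have h1 := Submodule.finrank_sup_add_finrank_inf_eq U W
  have h2 := Submodule.finrank_le (U ⊔ W)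
  obtain ⟨z, hz, hz0⟩ := exists_mem_notMem_of_finrank_lt (U := U ⊓ W) (W := ⊥)
    (by rw [finrank_bot]; omega)
  exact ⟨z, hz.1, hz.2, by simpa using hz0⟩

theorem finrank_span_pair_eq {x y : A} (hx : x ≠ 0) (hy : y ∉ Submodule.span ℝ {x}) :
    finrank ℝ (Submodule.span ℝ {x, y}) = 2 := by
  have := FiniteDimensional.span_of_finite ℝ (Set.toFinite {x, y})
  have hlt : Submodule.span ℝ {x} < Submodule.span ℝ {x, y} :=
    SetLike.lt_iff_le_and_exists.2 ⟨Submodule.span_mono (by simp), y,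
      Submodule.subset_span (by simp), hy⟩
  have h1 := Submodule.finrank_lt_finrank_of_lt hlt
  have h2 := finrank_span_pair_le x y
  rw [finrank_span_singleton hx] at h1
  omega

namespace PowerPlanar

variable [FiniteDimensional ℝ A] (hP : PowerPlanar m)

include hP

theorem centraliser_inf_eq {e x : A} (he0 : e ≠ 0) (hE : Exceptional m e)
    (hx : x ∈ centraliser m e) (hxe : x ∉ Submodule.span ℝ {e}) :
    centraliser m e ⊓ centraliser m x = Submodule.span ℝ {e, x} := by
  have heW : e ∈ centraliser m e ⊓ centraliser m x :=
    ⟨self_mem_centraliser e, mem_centraliser_comm.1 hx⟩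
  have hxW : x ∈ centraliser m e ⊓ centraliser m x := ⟨hx, self_mem_centraliser x⟩
  rcases Nat.lt_or_ge 2 (finrank ℝ ↥(centraliser m e ⊓ centraliser m x)) with h | h
  · exfalso
    have heq : centraliser m e ⊓ centraliser m x = centraliser m e :=
      Submodule.eq_of_le_of_finrank_le inf_le_left (by rw [hE.1]; exact h)
    have hle : centraliser m e ≤ centraliser m x := inf_eq_left.1 heq
    obtain ⟨y, hy, hyex⟩ := exists_mem_notMem_of_finrank_lt (U := centraliser m e)
      (W := Submodule.span ℝ {e, x}) (by rw [hE.1]; exact (finrank_span_pair_le e x).trans_lt (by norm_num))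
    have hspan := (span_triple_eq hE.1.le (self_mem_centraliser e) hx hy he0 hxe hyex).1
    have hley : centraliser m e ≤ centraliser m y := by
      rw [← hspan, Submodule.span_le]
      simp [Set.insert_subset_iff, mem_centraliser_comm.1 hy, self_mem_centraliser,
        mem_centraliser_comm.1 (hle hy)]
    have hall : ∀ q ∈ centraliser m e, centraliser m e ≤ centraliser m q := by
      intro q hq
      conv_lhs => rw [← hspan]
      rw [Submodule.span_le]
      simp [Set.insert_subset_iff, mem_centraliser_comm.1 hq, mem_centraliser_comm.1 (hle hq),
        mem_centraliser_comm.1 (hley hq)]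
    refine IsSubalg.finrank_ne_three (U := centraliser m e) (m := m) ?_ hP.eq_zero hE.1
    intro p hp q hq
    have hpq := mem_centraliser.1 (hall p hp hq)
    have : m p q = (1 / 2 : ℝ) • (m (p + q) (p + q) - m p p - m q q) := by
      simp only [map_add, LinearMap.add_apply, ← hpq]
      module
    rw [this]
    exact Submodule.smul_mem _ _ (Submodule.sub_mem _ (Submodule.sub_mem _
      (hE.2 _ (Submodule.add_mem _ hp hq)) (hE.2 _ hp)) (hE.2 _ hq))
  · exact (span_pair_eq h heW hxW he0 hxe).symm

theorem centraliser_ne_top {e x : A} (he0 : e ≠ 0) (hE : Exceptional m e)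
    (hx : x ∈ centraliser m e) (hxe : x ∉ Submodule.span ℝ {e}) : centraliser m x ≠ ⊤ := by
  intro h
  have h1 := hP.centraliser_inf_eq he0 hE hx hxe
  rw [h, inf_top_eq] at h1
  have h2 := finrank_span_pair_le e x
  rw [← h1, hE.1] at h2
  omega

theorem square_mem_span_pair_of_exceptional {e x : A} (he0 : e ≠ 0) (hE : Exceptional m e)
    (hx : x ∈ centraliser m e) (hxe : x ∉ Submodule.span ℝ {e}) :
    m x x ∈ Submodule.span ℝ {e, x} := by
  rw [← hP.centraliser_inf_eq he0 hE hx hxe]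
  exact ⟨hE.2 x hx, mem_centraliser.2 (hP.mul_square_comm x)⟩

theorem exists_idempotent_mem_span_square (hdim : finrank ℝ A = 4) {e b : A}
    (hE : Exceptional m e) (hb : b ∉ centraliser m e) (hbb : m b b ∉ Submodule.span ℝ {b}) :
    ∃ f ∈ centraliser m e, f ∉ Submodule.span ℝ {e} ∧ m f f = f ∧ b ∈ centraliser m f ∧
      m b b ∈ Submodule.span ℝ {f, b} := by
  have hb0 : b ≠ 0 := by
    rintro rfl
    exact hb (Submodule.zero_mem _)
  have hB2 := finrank_span_pair_eq hb0 hbb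
  have hbB : b ∈ Submodule.span ℝ {b, m b b} := Submodule.subset_span (by simp)
  obtain ⟨z, hzB, hz, hz0⟩ := Submodule.exists_mem_inf_ne_zero_of_finrank_lt
    (U := Submodule.span ℝ {b, m b b}) (W := centraliser m e) (by rw [hB2, hE.1, hdim]; norm_num)
  have hzz : m z z ∈ Submodule.span ℝ {z} := by
    by_contra hzz
    have h := span_pair_eq hB2.le hzB (hP.isSubalg b z hzB z hzB) hz0 hzz
    rw [← h] at hbB
    refine hb ((Submodule.span_le.2 ?_ : Submodule.span ℝ {z, m z z} ≤ _) hbB)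
    simp [Set.insert_subset_iff, hz, hE.2 z hz]
  obtain ⟨c, hc0, hc⟩ := exists_smul_idempotent hP.eq_zero hz0 hzz
  have hfB := Submodule.smul_mem _ c hzB
  have hf := Submodule.smul_mem _ c hz
  have hf0 : c • z ≠ 0 := smul_ne_zero hc0 hz0
  generalize c • z = f at *
  have hbf : b ∈ centraliser m f := mem_centraliser.2 (hP.comm b _ hfB _ hbB)
  refine ⟨f, hf, fun h => ?_, hc, hbf, ?_⟩
  · obtain ⟨k, rfl⟩ := Submodule.mem_span_singleton.1 h
    have hk : k ≠ 0 := by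
      rintro rfl
      simp at hf0
    rw [mem_centraliser_comm, Submodule.smul_mem_iff _ hk] at hbf
    exact hb (mem_centraliser_comm.1 hbf)
  · rw [span_pair_eq hB2.le hfB hbB hf0 fun h =>
      hb ((Submodule.span_singleton_le_iff_mem _ _).2 hf h)]
    exact Submodule.subset_span (by simp)

theorem exists_exceptional (hdim : finrank ℝ A = 4) {e a : A} (he : m e e = e) (he0 : e ≠ 0)
    (hE : Exceptional m e) (ha : a ∉ centraliser m e) :
    ∃ f ∈ centraliser m e, f ∉ Submodule.span ℝ {e} ∧ m f f = f ∧ a ∈ centraliser m f ∧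
      Exceptional m f := by
  have hae : a ∉ Submodule.span ℝ {e} := fun h =>
    ha ((Submodule.span_singleton_le_iff_mem _ _).2 (self_mem_centraliser e) h)
  have hJ := (finite_setOf_square_mem_span_singleton hP.eq_zero he0 hae).infinite_compl
  have hbt : ∀ t : ℝ, a + t • e ∉ centraliser m e := fun t h => ha <| by
    have := Submodule.sub_mem _ h (Submodule.smul_mem _ t (self_mem_centraliser (m := m) e))
    rwa [add_sub_cancel_right] at this
  choose! f hf hfe hff hbf hbb using fun t ht =>
    hP.exists_idempotent_mem_span_square hdim hE (hbt t) ht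
  have hfa : ∀ t ∈ {t : ℝ | m (a + t • e) (a + t • e) ∈ Submodule.span ℝ {a + t • e}}ᶜ,
      a ∈ centraliser m (f t) := fun t ht => by
    have := Submodule.sub_mem _ (hbf t ht) (Submodule.smul_mem _ t (mem_centraliser_comm.1 (hf t ht)))
    rwa [add_sub_cancel_right] at this
  have hV : finrank ℝ ↥(centraliser m e ⊓ centraliser m a) ≤ 2 := by
    by_contra! h
    have heq : centraliser m e ⊓ centraliser m a = centraliser m e :=
      Submodule.eq_of_le_of_finrank_le inf_le_left (by rw [hE.1]; exact h)
    exact ha (mem_centraliser_comm.1 (inf_eq_left.1 heq (self_mem_centraliser e)))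
  obtain ⟨t, ht, s, hs, hts, hfts⟩ := hJ.exists_ne_map_eq_of_mapsTo (f := f)
    (t := {f | f ∈ centraliser m e ⊓ centraliser m a ∧ m f f = f})
    (fun t ht => ⟨⟨hf t ht, mem_centraliser_comm.1 (hfa t ht)⟩, hff t ht⟩)
    (finite_setOf_idempotent hP.eq_zero _ hV)
  have hbbs := hbb s hs
  have hbbt := hbb t ht
  rw [← hfts] at hbbs
  have haf := hfa t ht
  have hffe := hfe t ht
  have hfce := hf t ht
  have hf2 := hff t ht
  clear hf hfe hff hbf hbb hfa
  generalize f t = g at *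
  refine ⟨g, hfce, hffe, hf2, haf, ?_⟩
  have hC : finrank ℝ (centraliser m g) ≤ 3 := by
    have := Submodule.finrank_lt (hP.centraliser_ne_top he0 hE hfce hffe)
    omega
  have heg : e ∈ centraliser m g := mem_centraliser_comm.1 hfce
  have haeg : a ∉ Submodule.span ℝ {e, g} := fun h => by
    refine ha ((Submodule.span_le.2 ?_ : Submodule.span ℝ {e, g} ≤ _) h)
    simp [Set.insert_subset_iff, hfce, self_mem_centraliser]
  obtain ⟨hspan, h3⟩ := span_triple_eq hC heg (self_mem_centraliser g) haf he0 hffe haeg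
  have hmem : ∀ t : ℝ, m (a + t • e) (a + t • e) ∈ Submodule.span ℝ {g, a + t • e} →
      m a a + t • (m a e + m e a) ∈ centraliser m g := by
    intro t ht
    have h1 : Submodule.span ℝ {g, a + t • e} ≤ centraliser m g := by
      rw [Submodule.span_le]
      simp [Set.insert_subset_iff, self_mem_centraliser, Submodule.add_mem _ haf (Submodule.smul_mem _ t heg)]
    have h2 := Submodule.sub_mem _ (h1 ht) (Submodule.smul_mem _ (t ^ 2) heg)
    convert h2 using 1
    simp only [map_add, map_smul, LinearMap.add_apply, LinearMap.smul_apply, he]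
    module
  have hs := hmem s hbbs
  have ht := hmem t hbbt
  have hae : m a e + m e a ∈ centraliser m g := by
    have := Submodule.sub_mem _ ht hs
    have h : (t - s) • (m a e + m e a) ∈ centraliser m g := by
      convert this using 1
      module
    exact (Submodule.smul_mem_iff _ (sub_ne_zero.2 hts)).1 h
  have haa : m a a ∈ centraliser m g := by
    have := Submodule.sub_mem _ ht (Submodule.smul_mem _ t hae)
    rwa [add_sub_cancel_right] at this
  refine ⟨h3, fun x hx => ?_⟩
  rw [← hspan] at hx
  obtain ⟨α, β, γ, rfl⟩ := Submodule.mem_span_triple.1 hx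
  have hga := hP.mul_mem_centraliser hf2 haf
  have hge := hP.mul_mem_centraliser hf2 heg
  have : m (α • e + β • g + γ • a) (α • e + β • g + γ • a) = (α ^ 2) • e + (β ^ 2) • g
      + (γ ^ 2) • m a a + (α * γ) • (m a e + m e a) + (2 * α * β) • m g e + (2 * β * γ) • m g a := by
    simp only [map_add, map_smul, LinearMap.add_apply, LinearMap.smul_apply, he, hf2,
      ← mem_centraliser.1 haf, ← mem_centraliser.1 heg]
    module
  rw [this]
  have hg := self_mem_centraliser (m := m) g
  apply_rules [Submodule.add_mem, Submodule.smul_mem]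

theorem not_exceptional (hdim : finrank ℝ A = 4) {e : A} (he : m e e = e) : ¬ Exceptional m e := by
  intro hE
  have he0 : e ≠ 0 := by
    rintro rfl
    have h := hE.1
    have : centraliser m 0 = ⊤ := by simp [centraliser]
    rw [this, finrank_top] at h
    omega
  obtain ⟨a, -, ha⟩ := exists_mem_notMem_of_finrank_lt (U := (⊤ : Submodule ℝ A))
    (W := centraliser m e) (by rw [hE.1, finrank_top]; omega)
  obtain ⟨f₁, hf₁, hf₁e, hff₁, haf₁, hE₁⟩ := hP.exists_exceptional hdim he he0 hE ha
  have hle : Submodule.span ℝ {e, f₁} ≤ centraliser m e := by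
    rw [Submodule.span_le]
    simp [Set.insert_subset_iff, hf₁, self_mem_centraliser]
  have hfin := finite_setOf_idempotent hP.eq_zero _ (finrank_span_pair_le e f₁)
  have hne : ∀ f : ({f | f ∈ Submodule.span ℝ {e, f₁} ∧ m f f = f} \ {0} : Set A),
      centraliser m (f : A) ≠ ⊤ := by
    rintro ⟨f, ⟨hf, hff⟩, hf0⟩
    by_cases hfe : f ∈ Submodule.span ℝ {e}
    · change centraliser m f ≠ ⊤
      rw [eq_of_idempotent_of_mem_span_singleton he hff he0 hf0 hfe]
      exact fun h => ha (h ▸ Submodule.mem_top)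
    · exact hP.centraliser_ne_top he0 hE (hle hf) hfe
  have : Finite ({f | f ∈ Submodule.span ℝ {e, f₁} ∧ m f f = f} \ {0} : Set A) := hfin.sdiff
  obtain ⟨a', ha'⟩ : ∃ a', ∀ f ∈ Submodule.span ℝ {e, f₁}, m f f = f → f ≠ 0 →
      a' ∉ centraliser m f := by
    by_contra! h
    obtain ⟨f, hf⟩ := Subspace.exists_eq_top_of_iUnion_eq_univ (p := fun f :
      ({f | f ∈ Submodule.span ℝ {e, f₁} ∧ m f f = f} \ {0} : Set A) => centraliser m (f : A)) <| by
        ext x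
        obtain ⟨f, h1, h2, h3, h4⟩ := h x
        simp only [Set.mem_iUnion, Set.mem_univ, iff_true]
        exact ⟨⟨f, ⟨h1, h2⟩, h3⟩, h4⟩
    exact hne f hf
  obtain ⟨f₂, hf₂, hf₂e, hff₂, haf₂, hE₂⟩ := hP.exists_exceptional hdim he he0 hE
    (ha' e (Submodule.subset_span (by simp)) he he0)
  have hf₁0 : f₁ ≠ 0 := by
    rintro rfl
    simp at hf₁e
  have hf₂0 : f₂ ≠ 0 := by
    rintro rfl
    simp at hf₂e
  have hf₂U : f₂ ∉ Submodule.span ℝ {e, f₁} := fun h => ha' f₂ h hff₂ hf₂0 haf₂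
  obtain ⟨b, ⟨hb₁, hb₂⟩, hbe⟩ := exists_mem_notMem_of_finrank_lt (U := centraliser m f₁ ⊓ centraliser m f₂)
    (W := Submodule.span ℝ {e}) <| by
      have h1 := Submodule.finrank_sup_add_finrank_inf_eq (centraliser m f₁) (centraliser m f₂)
      have h2 := Submodule.finrank_le (centraliser m f₁ ⊔ centraliser m f₂)
      rw [hE₁.1, hE₂.1] at h1
      rw [finrank_span_singleton he0]
      omega
  have hbC : b ∉ centraliser m e := by
    intro hb
    have h1 : b ∈ Submodule.span ℝ {e, f₁} := by
      rw [← hP.centraliser_inf_eq he0 hE hf₁ hf₁e]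
      exact ⟨hb, hb₁⟩
    have h2 : b ∈ Submodule.span ℝ {e, f₂} := by
      rw [← hP.centraliser_inf_eq he0 hE hf₂ hf₂e]
      exact ⟨hb, hb₂⟩
    obtain ⟨γ, δ, rfl⟩ := Submodule.mem_span_pair.1 h2
    have hδ : δ • f₂ ∈ Submodule.span ℝ {e, f₁} := by
      have := Submodule.sub_mem _ h1 (Submodule.smul_mem _ γ
        (Submodule.subset_span (by simp) : e ∈ Submodule.span ℝ {e, f₁}))
      rwa [add_sub_cancel_left] at this
    have : δ = 0 := by
      by_contra h
      exact hf₂U ((Submodule.smul_mem_iff _ h).1 hδ)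
    subst this
    exact hbe (Submodule.mem_span_singleton.2 ⟨γ, by simp⟩)
  refine Set.infinite_univ ((finite_setOf_square_mem_span_singleton hP.eq_zero he0 hbe).subset
    fun t _ => ?_)
  have hxe : b + t • e ∉ centraliser m e := fun h => hbC <| by
    have := Submodule.sub_mem _ h (Submodule.smul_mem _ t (self_mem_centraliser (m := m) e))
    rwa [add_sub_cancel_right] at this
  have hx₁ := Submodule.add_mem _ hb₁ (Submodule.smul_mem _ t (mem_centraliser_comm.1 hf₁))
  have hx₂ := Submodule.add_mem _ hb₂ (Submodule.smul_mem _ t (mem_centraliser_comm.1 hf₂))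
  have h1 := hP.square_mem_span_pair_of_exceptional hf₁0 hE₁ hx₁ fun h =>
    hxe ((Submodule.span_singleton_le_iff_mem _ _).2 hf₁ h)
  have h2 := hP.square_mem_span_pair_of_exceptional hf₂0 hE₂ hx₂ fun h =>
    hxe ((Submodule.span_singleton_le_iff_mem _ _).2 hf₂ h)
  change m (b + t • e) (b + t • e) ∈ Submodule.span ℝ {b + t • e}
  generalize b + t • e = x at *
  obtain ⟨p, q, hpq⟩ := Submodule.mem_span_pair.1 h1
  obtain ⟨r, s, hrs⟩ := Submodule.mem_span_pair.1 h2
  have hqs : q - s = 0 := coeff_eq_zero_of_notMem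
    (Submodule.sub_mem _ (Submodule.smul_mem _ p hf₁) (Submodule.smul_mem _ r hf₂)) hxe
    (by linear_combination (norm := module) hpq - hrs)
  have hr : r = 0 := coeff_eq_zero_of_notMem (U := Submodule.span ℝ {e, f₁}) (x := -(p • f₁))
    (Submodule.neg_mem _ (Submodule.smul_mem _ p (Submodule.subset_span (by simp)))) hf₂U
    (by
      rw [sub_eq_zero.1 hqs] at hpq
      linear_combination (norm := module) hrs - hpq)
  rw [← hrs, hr]
  exact Submodule.mem_span_singleton.2 ⟨s, by simp⟩

end PowerPlanar

end Exceptional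

section Central

variable {A : Type*} [AddCommGroup A] [Module ℝ A] {m : A →ₗ[ℝ] A →ₗ[ℝ] A}

theorem coeff_triple_eq_zero {x y z : A} (hx : x ≠ 0) (hy : y ∉ Submodule.span ℝ {x})
    (hz : z ∉ Submodule.span ℝ {x, y}) {a b c : ℝ} (h : a • x + b • y + c • z = 0) :
    a = 0 ∧ b = 0 ∧ c = 0 := by
  have hc : c = 0 := coeff_eq_zero_of_notMem (Submodule.mem_span_pair.2 ⟨a, b, rfl⟩) hz
    ((add_comm _ _).trans h)
  subst hc
  have := coeff_pair_eq_zero hx hy (a := a) (b := b) (by simpa using h)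
  exact ⟨this.1, this.2, rfl⟩

/-- The linear map `y ↦ e·y + y·e - y`. -/
def peirceMap (m : A →ₗ[ℝ] A →ₗ[ℝ] A) (e : A) : A →ₗ[ℝ] A :=
  m e + m.flip e - LinearMap.id

theorem peirceMap_apply (e y : A) : peirceMap m e y = m e y + m y e - y := by
  simp [peirceMap]

/-- `z` commutes with `e` and `e·z` lies in the span of `e` and `z`. -/
def IsCentralEigen (m : A →ₗ[ℝ] A →ₗ[ℝ] A) (e z : A) : Prop :=
  z ∈ centraliser m e ∧ m e z ∈ Submodule.span ℝ {e, z}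

theorem mul_self_add_smul {e y : A} (he : m e e = e) (t : ℝ) :
    m (e + t • y) (e + t • y) = e + t • y + t • (peirceMap m e y + t • m y y) := by
  simp only [peirceMap_apply, map_add, map_smul, LinearMap.add_apply, LinearMap.smul_apply, he]
  module

theorem peirceMap_add_mem {e y : A} (he : m e e = e) {t : ℝ} (ht : t ≠ 0) :
    peirceMap m e y + t • m y y ∈
      Submodule.span ℝ {e + t • y, m (e + t • y) (e + t • y)} := by
  rw [← Submodule.smul_mem_iff _ ht]
  refine Submodule.mem_span_pair.2 ⟨-1, 1, ?_⟩
  rw [mul_self_add_smul he]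
  module

theorem mem_span_pair_of_not_linearIndependent {x y z : A} (hx : x ≠ 0)
    (hy : y ∉ Submodule.span ℝ {x}) (h : ¬ LinearIndependent ℝ ![x, y, z]) :
    z ∈ Submodule.span ℝ {x, y} := by
  by_contra hz
  exact h (linearIndependent_triple hx hy hz)

namespace PowerPlanar

section

variable (hP : PowerPlanar m)

include hP

theorem exists_idempotent [Nontrivial A] : ∃ e : A, e ≠ 0 ∧ m e e = e := by
  suffices h : ∃ x : A, x ≠ 0 ∧ m x x ∈ Submodule.span ℝ {x} by
    obtain ⟨x, hx, hxx⟩ := h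
    obtain ⟨c, hc, h⟩ := exists_smul_idempotent hP.eq_zero hx hxx
    exact ⟨c • x, smul_ne_zero hc hx, h⟩
  obtain ⟨u, hu⟩ := exists_ne (0 : A)
  by_cases huu : m u u ∈ Submodule.span ℝ {u}
  · exact ⟨u, hu, huu⟩
  have hv : m u u ≠ 0 := fun h => huu (h ▸ Submodule.zero_mem _)
  have huB : u ∈ Submodule.span ℝ {u, m u u} := Submodule.subset_span (by simp)
  have hvB : m u u ∈ Submodule.span ℝ {u, m u u} := Submodule.subset_span (by simp)
  obtain ⟨α, β, hs⟩ := Submodule.mem_span_pair.1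
    (Submodule.add_mem _ (hP.isSubalg u _ huB _ hvB) (hP.isSubalg u _ hvB _ huB))
  obtain ⟨γ, δ, hvv⟩ := Submodule.mem_span_pair.1 (hP.isSubalg u _ hvB _ hvB)
  by_cases hγ : γ = 0
  · exact ⟨m u u, hv, Submodule.mem_span_singleton.2 ⟨δ, by simpa [hγ] using hvv⟩⟩
  obtain ⟨t, ht⟩ := Polynomial.exists_isRoot_of_odd_natDegree_of_real
    (p := .C γ * .X ^ 3 + .C (α - δ) * .X ^ 2 + .C (-β) * .X + .C (-1))
    (by rw [Polynomial.natDegree_cubic hγ]; decide)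
  simp only [Polynomial.IsRoot.def, Polynomial.eval_add, Polynomial.eval_mul, Polynomial.eval_C,
    Polynomial.eval_pow, Polynomial.eval_X] at ht
  refine ⟨u + t • m u u, fun h => ?_, Submodule.mem_span_singleton.2 ⟨t * α + t ^ 2 * γ, ?_⟩⟩
  · have := coeff_pair_eq_zero hu huu (a := 1) (b := t) (by simpa using h)
    exact one_ne_zero this.1
  · have h : m (u + t • m u u) (u + t • m u u) = m u u + t • (m u (m u u) + m (m u u) u)
        + t ^ 2 • m (m u u) (m u u) := by
      simp only [map_add, map_smul, LinearMap.add_apply, LinearMap.smul_apply]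
      module
    rw [h, ← hs, ← hvv]
    have h1 : t * (t * α + t ^ 2 * γ) = 1 + t * β + t ^ 2 * δ := by linear_combination ht
    have h2 := congrArg (fun c : ℝ => c • m u u) h1
    linear_combination (norm := module) h2

end

variable [FiniteDimensional ℝ A] (hP : PowerPlanar m)

include hP

theorem isCentralEigen_peirceMap {e : A} (he : m e e = e) (he0 : e ≠ 0) (y : A) :
    IsCentralEigen m e (peirceMap m e y) := by
  refine ⟨by simpa only [peirceMap_apply] using hP.anticommutator_sub_mem_centraliser he y, ?_⟩
  by_cases hy : peirceMap m e y ∈ Submodule.span ℝ {e}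
  · obtain ⟨c, hc⟩ := Submodule.mem_span_singleton.1 hy
    rw [← hc, map_smul, he]
    exact Submodule.smul_mem _ _ (Submodule.subset_span (by simp))
  refine mem_span_pair_of_not_linearIndependent he0 hy <| not_linearIndependent_of_tendsto_zero
    (p₁ := y) (q₁ := m y y) (r₁ := m e (m y y) + m y (peirceMap m e y)) (r₂ := m y (m y y))
    fun t ht => ?_
  have hx : e + t • y ∈ Submodule.span ℝ {e + t • y, m (e + t • y) (e + t • y)} :=
    Submodule.subset_span (by simp)
  have hq := peirceMap_add_mem he ht (y := y)
  refine not_linearIndependent_of_mem (finrank_span_pair_le _ _) hx hq ?_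
  convert hP.isSubalg _ _ hx _ hq using 1
  simp only [map_add, map_smul, LinearMap.add_apply, LinearMap.smul_apply]
  module

theorem isCentralEigen_square {e y : A} (he : m e e = e) (he0 : e ≠ 0)
    (hy : peirceMap m e y = 0) :
    IsCentralEigen m e (m y y) ∧ m (m y y) (m y y) ∈ Submodule.span ℝ {e, m y y} := by
  have hN : ∀ t : ℝ, t ≠ 0 → m y y ∈
      Submodule.span ℝ {e + t • y, m (e + t • y) (e + t • y)} := by
    intro t ht
    have := peirceMap_add_mem he ht (y := y)
    rwa [hy, zero_add, Submodule.smul_mem_iff _ ht] at this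
  have hx : ∀ t : ℝ, e + t • y ∈ Submodule.span ℝ {e + t • y, m (e + t • y) (e + t • y)} :=
    fun t => Submodule.subset_span (by simp)
  have hC : m y y ∈ centraliser m e := by
    rw [mem_centraliser]
    have h := hP.comm _ _ (hx 1) _ (hN 1 one_ne_zero)
    have h' := hP.mul_square_comm y
    simp only [map_add, map_smul, LinearMap.add_apply, LinearMap.smul_apply] at h
    linear_combination (norm := module) h - h'
  by_cases hNe : m y y ∈ Submodule.span ℝ {e}
  · obtain ⟨c, hc⟩ := Submodule.mem_span_singleton.1 hNe
    refine ⟨⟨hC, ?_⟩, ?_⟩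
    · rw [← hc, map_smul, he]
      exact Submodule.smul_mem _ _ (Submodule.subset_span (by simp))
    · rw [← hc, map_smul, map_smul, LinearMap.smul_apply, he]
      exact Submodule.smul_mem _ _ (Submodule.smul_mem _ _ (Submodule.subset_span (by simp)))
  refine ⟨⟨hC, mem_span_pair_of_not_linearIndependent he0 hNe <|
    not_linearIndependent_of_tendsto_zero (p₁ := y) (q₁ := 0) (r₁ := m y (m y y)) (r₂ := 0)
    fun t ht => ?_⟩, mem_span_pair_of_not_linearIndependent he0 hNe <|
    not_linearIndependent_of_tendsto_zero (p₁ := y) (q₁ := 0) (r₁ := 0) (r₂ := 0)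
    fun t ht => ?_⟩
  · refine not_linearIndependent_of_mem (finrank_span_pair_le _ _) (hx t)
      (by simpa using hN t ht) ?_
    convert hP.isSubalg _ _ (hx t) _ (hN t ht) using 1
    simp
  · exact not_linearIndependent_of_mem (finrank_span_pair_le _ _) (hx t)
      (by simpa using hN t ht) (by simpa using hP.isSubalg _ _ (hN t ht) _ (hN t ht))

theorem not_isCentralEigen_combination {e z₁ z₂ : A} (he : m e e = e) (he0 : e ≠ 0)
    (hE : ¬ Exceptional m e) (hC : finrank ℝ (centraliser m e) ≤ 3) (h₁ : IsCentralEigen m e z₁)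
    (h₂ : IsCentralEigen m e z₂) (hz₁ : z₁ ∉ Submodule.span ℝ {e})
    (hz₂ : z₂ ∉ Submodule.span ℝ {e, z₁}) {α β γ : ℝ} (hα : α ≠ 0) (hβ : β ≠ 0) :
    ¬ IsCentralEigen m e (γ • e + α • z₁ + β • z₂) := by
  intro hw
  obtain ⟨a₁, b₁, hb₁⟩ := Submodule.mem_span_pair.1 h₁.2
  obtain ⟨a₂, b₂, hb₂⟩ := Submodule.mem_span_pair.1 h₂.2
  obtain ⟨c, d, hd⟩ := Submodule.mem_span_pair.1 hw.2
  simp only [map_add, map_smul, he, ← hb₁, ← hb₂] at hd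
  obtain ⟨-, h1, h2⟩ := coeff_triple_eq_zero he0 hz₁ hz₂ (a := γ + α * a₁ + β * a₂ - c - d * γ)
    (b := α * (b₁ - d)) (c := β * (b₂ - d)) (by linear_combination (norm := module) -hd)
  have hb₁d : b₁ = d := sub_eq_zero.1 ((mul_eq_zero.1 h1).resolve_left hα)
  have hb₂d : b₂ = d := sub_eq_zero.1 ((mul_eq_zero.1 h2).resolve_left hβ)
  subst hb₁d
  subst hb₂d
  obtain ⟨hspan, h3⟩ := span_triple_eq hC (self_mem_centraliser e) h₁.1 h₂.1 he0 hz₁ hz₂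
  refine hE ⟨h3, fun x hx => ?_⟩
  have hxe := mem_centraliser.1 hx
  obtain ⟨k, hk⟩ : ∃ k : ℝ, m e x = k • e + b₂ • x := by
    rw [← hspan] at hx
    obtain ⟨p, q, r, rfl⟩ := Submodule.mem_span_triple.1 hx
    refine ⟨p + q * a₁ + r * a₂ - b₂ * p, ?_⟩
    simp only [map_add, map_smul, he, ← hb₁, ← hb₂]
    module
  have h := hP.mul_square_comm_polarized x e
  rw [← hxe, hk] at h
  simp only [map_add, map_smul, LinearMap.add_apply, LinearMap.smul_apply, ← hxe] at h
  rw [mem_centraliser]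
  linear_combination (norm := module) h

theorem two_le_finrank_ker_peirceMap (hdim : finrank ℝ A = 4) {e : A} (he : m e e = e)
    (he0 : e ≠ 0) (hE : ¬ Exceptional m e) (hC : finrank ℝ (centraliser m e) ≤ 3) :
    2 ≤ finrank ℝ (LinearMap.ker (peirceMap m e)) := by
  obtain ⟨u, hu⟩ : ∃ u, LinearMap.range (peirceMap m e) ≤ Submodule.span ℝ {e, u} := by
    by_cases h : ∀ y, peirceMap m e y ∈ Submodule.span ℝ {e}
    · refine ⟨e, ?_⟩
      rintro _ ⟨y, rfl⟩
      simpa using h y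
    · push Not at h
      obtain ⟨y₁, hy₁⟩ := h
      refine ⟨peirceMap m e y₁, ?_⟩
      rintro _ ⟨y, rfl⟩
      by_contra hy
      refine hP.not_isCentralEigen_combination he he0 hE hC (hP.isCentralEigen_peirceMap he he0 y₁)
        (hP.isCentralEigen_peirceMap he he0 y) hy₁ hy (γ := 0) one_ne_zero one_ne_zero ?_
      simpa using hP.isCentralEigen_peirceMap he he0 (y₁ + y)
  have h1 := (Submodule.finrank_mono hu).trans (finrank_span_pair_le e u)
  have h2 := LinearMap.finrank_range_add_finrank_ker (peirceMap m e)
  omega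

theorem exists_isSubalg_square_mem {e : A} (he : m e e = e) (he0 : e ≠ 0)
    (hE : ¬ Exceptional m e) (hC : finrank ℝ (centraliser m e) ≤ 3) :
    ∃ M : Submodule ℝ A, IsSubalg m M ∧ finrank ℝ M ≤ 2 ∧ e ∈ M ∧
      ∀ y ∈ LinearMap.ker (peirceMap m e), m y y ∈ M := by
  by_cases h : ∀ y ∈ LinearMap.ker (peirceMap m e), m y y ∈ Submodule.span ℝ {e}
  · refine ⟨_, fun x hx y hy => ?_, (finrank_span_singleton he0).le.trans one_le_two,
      Submodule.mem_span_singleton_self e, h⟩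
    obtain ⟨s, rfl⟩ := Submodule.mem_span_singleton.1 hx
    obtain ⟨t, rfl⟩ := Submodule.mem_span_singleton.1 hy
    rw [map_smul, map_smul, LinearMap.smul_apply, he]
    exact Submodule.smul_mem _ _ (Submodule.smul_mem _ _ (Submodule.mem_span_singleton_self e))
  push Not at h
  obtain ⟨y₁, hy₁, hN₁⟩ := h
  obtain ⟨hE₁, hNN₁⟩ := hP.isCentralEigen_square he he0 hy₁
  have heM : e ∈ Submodule.span ℝ {e, m y₁ y₁} := Submodule.subset_span (by simp)
  refine ⟨Submodule.span ℝ {e, m y₁ y₁}, fun x hx y hy => ?_, finrank_span_pair_le _ _, heM,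
    fun y₂ hy₂ => ?_⟩
  · obtain ⟨s, t, rfl⟩ := Submodule.mem_span_pair.1 hx
    obtain ⟨s', t', rfl⟩ := Submodule.mem_span_pair.1 hy
    have h : m (s • e + t • m y₁ y₁) (s' • e + t' • m y₁ y₁) = (s * s') • e
        + (s * t' + t * s') • m e (m y₁ y₁) + (t * t') • m (m y₁ y₁) (m y₁ y₁) := by
      simp only [map_add, map_smul, LinearMap.add_apply, LinearMap.smul_apply, he,
        ← mem_centraliser.1 hE₁.1]
      module
    rw [h]
    exact Submodule.add_mem _ (Submodule.add_mem _ (Submodule.smul_mem _ _ heM)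
      (Submodule.smul_mem _ _ hE₁.2)) (Submodule.smul_mem _ _ hNN₁)
  by_contra hN₂
  obtain ⟨hE₂, -⟩ := hP.isCentralEigen_square he he0 hy₂
  have hker : ∀ t : ℝ, y₁ + t • y₂ ∈ LinearMap.ker (peirceMap m e) := fun t =>
    Submodule.add_mem _ hy₁ (Submodule.smul_mem _ t hy₂)
  have hsq : ∀ t : ℝ, m (y₁ + t • y₂) (y₁ + t • y₂)
      = m y₁ y₁ + t • (m y₁ y₂ + m y₂ y₁) + t ^ 2 • m y₂ y₂ := by
    intro t
    simp only [map_add, map_smul, LinearMap.add_apply, LinearMap.smul_apply]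
    module
  have h12 : m y₁ y₂ + m y₂ y₁ ∈ centraliser m e := by
    have h := (hP.isCentralEigen_square he he0 (hker 1)).1.1
    rw [hsq] at h
    convert Submodule.sub_mem _ (Submodule.sub_mem _ h hE₁.1) hE₂.1 using 1
    module
  rw [← (span_triple_eq hC (self_mem_centraliser e) hE₁.1 hE₂.1 he0 hN₁ hN₂).1] at h12
  obtain ⟨γ, α, β, h12⟩ := Submodule.mem_span_triple.1 h12
  obtain ⟨t, ht⟩ := Infinite.exists_notMem_finset ({0, -β, -α⁻¹} : Finset ℝ)
  simp only [Finset.mem_insert, Finset.mem_singleton, not_or] at ht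
  have hα : 1 + t * α ≠ 0 := by
    intro h
    have hα0 : α ≠ 0 := by
      rintro rfl
      simp at h
    refine ht.2.2 ?_
    field_simp
    linarith
  have hβ : t * (t + β) ≠ 0 := mul_ne_zero ht.1 fun h => ht.2.1 (eq_neg_of_add_eq_zero_left h)
  refine hP.not_isCentralEigen_combination he he0 hE hC hE₁ hE₂ hN₁ hN₂ (γ := t * γ) hα hβ ?_
  convert (hP.isCentralEigen_square he he0 (hker t)).1 using 1
  rw [hsq, ← h12]
  module

theorem square_square_mem_span_singleton {M : Submodule ℝ A} (hM : IsSubalg m M) {y : A}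
    (hy : y ∉ M) (hyy : m y y ∈ M) : m (m y y) (m y y) ∈ Submodule.span ℝ {m y y} := by
  have hy0 : y ≠ 0 := by
    rintro rfl
    exact hy (Submodule.zero_mem _)
  have hyy0 : m y y ≠ 0 := fun h => hy0 (or_self_iff.1 (hP.eq_zero _ _ h))
  have hyB : y ∈ Submodule.span ℝ {y, m y y} := Submodule.subset_span (by simp)
  have hyyB : m y y ∈ Submodule.span ℝ {y, m y y} := Submodule.subset_span (by simp)
  by_contra h
  rw [← span_pair_eq (finrank_span_pair_le _ _) hyyB (hP.isSubalg y _ hyyB _ hyyB) hyy0 h] at hyB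
  refine hy ((Submodule.span_le.2 ?_ : Submodule.span ℝ {m y y, m (m y y) (m y y)} ≤ M) hyB)
  simp [Set.insert_subset_iff, hyy, hM _ hyy _ hyy]

theorem square_mem_span_square {K M : Submodule ℝ A} (hM : IsSubalg m M) (hM2 : finrank ℝ M ≤ 2)
    (hKM : ∀ y ∈ K, m y y ∈ M) {y₁ y₂ : A} (hy₁ : y₁ ∈ K) (hy₁M : y₁ ∉ M) (hy₂ : y₂ ∈ K) :
    m y₂ y₂ ∈ Submodule.span ℝ {m y₁ y₁} := by
  have hker : ∀ t : ℝ, y₁ + t • y₂ ∈ K := fun t =>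
    Submodule.add_mem _ hy₁ (Submodule.smul_mem _ t hy₂)
  have hT : {t : ℝ | y₁ + t • y₂ ∈ M}.Finite := by
    refine Set.Subsingleton.finite fun s hs t ht => ?_
    by_contra hst
    have h : (s - t) • y₂ ∈ M := by
      convert Submodule.sub_mem _ hs ht using 1
      module
    have h2 := (Submodule.smul_mem_iff _ (sub_ne_zero.2 hst)).1 h
    exact hy₁M ((Submodule.add_mem_iff_left _ (Submodule.smul_mem _ s h2)).1 hs)
  have hex : ∀ t : (({t : ℝ | y₁ + t • y₂ ∈ M}ᶜ : Set ℝ)), ∃ f : ({f | f ∈ M ∧ m f f = f} : Set A),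
      m (y₁ + (t : ℝ) • y₂) (y₁ + (t : ℝ) • y₂) ∈ Submodule.span ℝ {(f : A)} := by
    rintro ⟨t, ht⟩
    change y₁ + t • y₂ ∉ M at ht
    have hyy := hKM _ (hker t)
    have hyy0 : m (y₁ + t • y₂) (y₁ + t • y₂) ≠ 0 := fun h => ht (by
      rw [or_self_iff.1 (hP.eq_zero _ _ h)]
      exact Submodule.zero_mem _)
    obtain ⟨c, hc0, hc⟩ := exists_smul_idempotent hP.eq_zero hyy0
      (hP.square_square_mem_span_singleton hM ht hyy)
    exact ⟨⟨_, Submodule.smul_mem _ c hyy, hc⟩,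
      Submodule.mem_span_singleton.2 ⟨c⁻¹, inv_smul_smul₀ hc0 _⟩⟩
  choose g hg using hex
  have : Infinite ({t : ℝ | y₁ + t • y₂ ∈ M}ᶜ : Set ℝ) := hT.infinite_compl.to_subtype
  have : Finite ({f | f ∈ M ∧ m f f = f} : Set A) := finite_setOf_idempotent hP.eq_zero M hM2
  obtain ⟨f, hf⟩ := Finite.exists_infinite_fiber g
  let τ := Infinite.natEmbedding (g ⁻¹' {f})
  have hτ : ∀ n, m y₁ y₁ + (τ n : ℝ) • (m y₁ y₂ + m y₂ y₁) + (τ n : ℝ) ^ 2 • m y₂ y₂ ∈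
      Submodule.span ℝ {(f : A)} := by
    intro n
    have h := hg (τ n)
    rw [show g (τ n) = f from (τ n).2] at h
    convert h using 1
    simp only [map_add, map_smul, LinearMap.add_apply, LinearMap.smul_apply]
    module
  have hne : ∀ i j, i ≠ j → (τ i : ℝ) - τ j ≠ 0 := fun i j hij h =>
    hij (τ.injective (Subtype.ext (Subtype.ext (sub_eq_zero.1 h))))
  have hlin : ∀ i j, i ≠ j → m y₁ y₂ + m y₂ y₁ + ((τ i : ℝ) + τ j) • m y₂ y₂ ∈
      Submodule.span ℝ {(f : A)} := by
    intro i j hij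
    rw [← Submodule.smul_mem_iff _ (hne i j hij)]
    convert Submodule.sub_mem _ (hτ i) (hτ j) using 1
    module
  have h2 : m y₂ y₂ ∈ Submodule.span ℝ {(f : A)} := by
    rw [← Submodule.smul_mem_iff _ (hne 1 2 (by decide))]
    convert Submodule.sub_mem _ (hlin 0 1 (by decide)) (hlin 0 2 (by decide)) using 1
    module
  have h12 := (Submodule.add_mem_iff_left _ (Submodule.smul_mem _ _ h2)).1 (hlin 0 1 (by decide))
  have h1 := (Submodule.add_mem_iff_left _ (Submodule.smul_mem _ _ h12)).1
    ((Submodule.add_mem_iff_left _ (Submodule.smul_mem _ _ h2)).1 (hτ 0))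
  obtain ⟨c, hc⟩ := Submodule.mem_span_singleton.1 h1
  obtain ⟨d, hd⟩ := Submodule.mem_span_singleton.1 h2
  have hc0 : c ≠ 0 := by
    rintro rfl
    have := or_self_iff.1 (hP.eq_zero y₁ y₁ (by simpa using hc.symm))
    exact hy₁M (this ▸ Submodule.zero_mem _)
  refine Submodule.mem_span_singleton.2 ⟨d / c, ?_⟩
  rw [← hc, ← hd, smul_smul, div_mul_cancel₀ _ hc0]

theorem exceptional_of_square_mem_span_singleton {K : Submodule ℝ A} (hK : 2 ≤ finrank ℝ K) {f : A}
    (hf : m f f = f) (hf0 : f ≠ 0) (hC : finrank ℝ (centraliser m f) ≤ 3)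
    (hKf : ∀ y ∈ K, m y y ∈ Submodule.span ℝ {f}) : Exceptional m f := by
  have hle : K ≤ centraliser m f := by
    intro y hy
    obtain ⟨k, hk⟩ := Submodule.mem_span_singleton.1 (hKf y hy)
    by_cases hk0 : k = 0
    · rw [hk0, zero_smul] at hk
      rw [or_self_iff.1 (hP.eq_zero _ _ hk.symm)]
      exact Submodule.zero_mem _
    · have h := hP.mul_square_comm y
      rw [← hk, map_smul, map_smul, LinearMap.smul_apply] at h
      exact mem_centraliser.2 (smul_right_injective A hk0 h).symm
  have hfK : f ∉ K := by
    intro hfK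
    obtain ⟨y, hy, hyf⟩ := exists_mem_notMem_of_finrank_lt (U := K) (W := Submodule.span ℝ {f})
      (by rw [finrank_span_singleton hf0]; omega)
    have hfy : m f y ∈ Submodule.span ℝ {f} := by
      have h1 := Submodule.sub_mem _ (Submodule.sub_mem _ (hKf _ (Submodule.add_mem _ hy hfK))
        (hKf y hy)) (hKf f hfK)
      rw [← Submodule.smul_mem_iff _ (two_ne_zero : (2 : ℝ) ≠ 0)]
      convert h1 using 1
      simp only [map_add, LinearMap.add_apply, ← mem_centraliser.1 (hle hy)]
      module
    obtain ⟨k, hk⟩ := Submodule.mem_span_singleton.1 hfy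
    have h : m f (y - k • f) = 0 := by
      rw [map_sub, map_smul, hf, hk, sub_self]
    have := (hP.eq_zero _ _ h).resolve_left hf0
    exact hyf (Submodule.mem_span_singleton.2 ⟨k, (sub_eq_zero.1 this).symm⟩)
  have hlt : K < K ⊔ Submodule.span ℝ {f} := SetLike.lt_iff_le_and_exists.2
    ⟨le_sup_left, f, Submodule.mem_sup_right (Submodule.mem_span_singleton_self f), hfK⟩
  have hle' : K ⊔ Submodule.span ℝ {f} ≤ centraliser m f := by
    refine sup_le hle ?_
    simp [self_mem_centraliser]
  have h1 := Submodule.finrank_lt_finrank_of_lt hlt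
  have h2 := Submodule.finrank_mono hle'
  have heq := Submodule.eq_of_le_of_finrank_le hle' (by omega)
  refine ⟨by omega, fun x hx => ?_⟩
  rw [← heq] at hx
  obtain ⟨y, hy, z, hz, rfl⟩ := Submodule.mem_sup.1 hx
  obtain ⟨c, rfl⟩ := Submodule.mem_span_singleton.1 hz
  have hfy := hP.mul_mem_centraliser hf (hle hy)
  have hyy : m y y ∈ centraliser m f :=
    (Submodule.span_singleton_le_iff_mem _ _).2 (self_mem_centraliser f) (hKf y hy)
  have : m (y + c • f) (y + c • f) = m y y + (2 * c) • m f y + c ^ 2 • f := by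
    simp only [map_add, map_smul, LinearMap.add_apply, LinearMap.smul_apply, hf,
      ← mem_centraliser.1 (hle hy)]
    module
  rw [this]
  exact Submodule.add_mem _ (Submodule.add_mem _ hyy (Submodule.smul_mem _ _ hfy))
    (Submodule.smul_mem _ _ (self_mem_centraliser f))

theorem exists_central_idempotent (hdim : finrank ℝ A = 4) :
    ∃ e : A, e ≠ 0 ∧ m e e = e ∧ centraliser m e = ⊤ := by
  by_contra! hne
  have hC : ∀ f, f ≠ 0 → m f f = f → finrank ℝ (centraliser m f) ≤ 3 := by
    intro f hf0 hf
    have := Submodule.finrank_lt (hne f hf0 hf)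
    omega
  have : Nontrivial A := nontrivial_of_finrank_pos (R := ℝ) (by omega)
  obtain ⟨e, he0, he⟩ := hP.exists_idempotent
  have hE := hP.not_exceptional hdim he
  have hK := hP.two_le_finrank_ker_peirceMap hdim he he0 hE (hC e he0 he)
  obtain ⟨M, hM, hM2, heM, hKM⟩ := hP.exists_isSubalg_square_mem he he0 hE (hC e he0 he)
  obtain ⟨y₁, hy₁, hy₁M⟩ : ∃ y₁ ∈ LinearMap.ker (peirceMap m e), y₁ ∉ M := by
    by_contra! hle
    rw [← Submodule.eq_of_le_of_finrank_le hle (hM2.trans hK), LinearMap.mem_ker,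
      peirceMap_apply, he, add_sub_cancel_right] at heM
    exact he0 heM
  have hyy0 : m y₁ y₁ ≠ 0 := fun h => hy₁M (by
    rw [or_self_iff.1 (hP.eq_zero _ _ h)]
    exact Submodule.zero_mem _)
  obtain ⟨c, hc0, hc⟩ := exists_smul_idempotent hP.eq_zero hyy0
    (hP.square_square_mem_span_singleton hM hy₁M (hKM _ hy₁))
  have hf0 := smul_ne_zero hc0 hyy0
  refine hP.not_exceptional hdim hc (hP.exceptional_of_square_mem_span_singleton hK hc hf0
    (hC _ hf0 hc) fun y hy => ?_)
  rw [Submodule.span_singleton_smul_eq hc0.isUnit]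
  exact hP.square_mem_span_square hM hM2 hKM hy₁ hy₁M hy

end PowerPlanar

end Central

/-- A four-dimensional power-commutative real division algebra contains
no exceptional idempotent, and consequently contains a nonzero central idempotent. -/
theorem stmt_19 {A : Type*} [AddCommGroup A] [Module ℝ A] [FiniteDimensional ℝ A]
    (m : A →ₗ[ℝ] A →ₗ[ℝ] A)
    (hdim : Module.finrank ℝ A = 4)
    (hdiv : IsDivision m) (hpc : PowerComm m) :
    (∀ e : A, m e e = e → ¬ Exceptional m e) ∧
    (∃ e : A, e ≠ 0 ∧ m e e = e ∧ centraliser m e = ⊤) := by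
  have hP := hpc.powerPlanar hdim hdiv
  exact ⟨fun e he => hP.not_exceptional hdim he, hP.exists_central_idempotent hdim⟩
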